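/- arXiv:2411.05417 — 2 statements merged into one kernel-verified Lean document; each statement's English description precedes it below -/
import Mathlib

section
/- Let 𝒳 ⊆ ℝ^d be a nonempty closed convex set, ν ∈ (0, 1], L > 0, σ > 0, and let f : ℝ^d → ℝ be differentiable with ‖∇f(y) − ∇f(x)‖ ≤ L‖y − x‖^ν for all x, y ∈ 𝒳 and f(x) ≥ f* for all x ∈ 𝒳. On a probability space with a filtration (𝓕_k)_{k≥0}, let γ_k > 0 be stepsizes, m_k ≥ 1 batch sizes, x_0 ∈ 𝒳 deterministic, and let (x_k) and (G_k) be sequences of random vectors in ℝ^d such that for each k: x_k is 𝓕_k-measurable with values in 𝒳; G_k is integrable with E[G_k | 𝓕_k] = ∇f(x_k) a.s., E[‖∇f(x_k) − G_k‖²] ≤ σ²/m_k, and E[‖G_k‖^{1+ν}] ≤ σ^{1+ν}; and x_{k+1} is almost surely the Euclidean projection of x_k − γ_k G_k onto 𝒳, i.e. x_{k+1} ∈ 𝒳 and ⟨x_k − γ_k G_k − x_{k+1}, y − x_{k+1}⟩ ≤ 0 for all y ∈ 𝒳. Set g̃_k := (x_k − x_{k+1})/γ_k. Then for every N ≥ 1,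 Σ_{k=0}^{N−1} γ_k E[‖g̃_k‖²] ≤ Δ + σ² Σ_{k=0}^{N−1} (γ_k/m_k) + (L σ^{1+ν}/(1+ν)) Σ_{k=0}^{N−1} γ_k^{1+ν}, where Δ := f(x_0) − f*. -/
open MeasureTheory InnerProductSpace

/-- Descent inequality for a Hölder gradient on a convex set. -/
lemma spg_descent {d : ℕ} {𝒳 : Set (EuclideanSpace ℝ (Fin d))} (h𝒳conv : Convex ℝ 𝒳)
    {ν : ℝ} (hν : 0 < ν) {L : ℝ} (f : EuclideanSpace ℝ (Fin d) → ℝ) (hf : Differentiable ℝ f)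
    (hHolder : ∀ x ∈ 𝒳, ∀ y ∈ 𝒳, ‖gradient f y - gradient f x‖ ≤ L * ‖y - x‖ ^ ν)
    {x y : EuclideanSpace ℝ (Fin d)} (hx : x ∈ 𝒳) (hy : y ∈ 𝒳) :
    f y ≤ f x + ⟪gradient f x, y - x⟫_ℝ + L / (1 + ν) * ‖y - x‖ ^ (1 + ν) := by
  set v := y - x with hv
  let h : ℝ → ℝ := fun t => f (x + t • v) - t * ⟪gradient f x, v⟫_ℝ
    - L / (1 + ν) * ‖v‖ ^ (1 + ν) * t ^ (1 + ν)
  have hd : ∀ t, HasDerivAt h (⟪gradient f (x + t • v), v⟫_ℝ - ⟪gradient f x, v⟫_ℝ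
      - L / (1 + ν) * ‖v‖ ^ (1 + ν) * ((1 + ν) * t ^ ν)) t := by
    intro t
    have h1 : HasDerivAt (fun t : ℝ => x + t • v) v t := by
      simpa using ((hasDerivAt_id t).smul_const v).const_add x
    have h2 : HasDerivAt (fun t : ℝ => f (x + t • v)) ⟪gradient f (x + t • v), v⟫_ℝ t := by
      have := (hf (x + t • v)).hasGradientAt.hasFDerivAt.comp_hasDerivAt t h1
      rw [toDual_apply_apply] at this
      exact this
    have h3 : HasDerivAt (fun t : ℝ => t * ⟪gradient f x, v⟫_ℝ) ⟪gradient f x, v⟫_ℝ t := by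
      simpa using (hasDerivAt_id t).mul_const ⟪gradient f x, v⟫_ℝ
    have h4 : HasDerivAt (fun t : ℝ => t ^ (1 + ν)) ((1 + ν) * t ^ ν) t := by
      have := Real.hasDerivAt_rpow_const (x := t) (p := 1 + ν) (Or.inr (by linarith))
      simpa using this
    exact (h2.sub h3).sub (h4.const_mul _)
  have hanti : AntitoneOn h (Set.Icc 0 1) := by
    apply antitoneOn_of_deriv_nonpos (convex_Icc 0 1)
    · exact fun t _ => (hd t).continuousAt.continuousWithinAt
    · exact fun t _ => (hd t).differentiableAt.differentiableWithinAt
    · intro t ht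
      rw [interior_Icc] at ht
      rw [(hd t).deriv]
      have hz : x + t • v ∈ 𝒳 := h𝒳conv.add_smul_sub_mem hx hy ⟨ht.1.le, ht.2.le⟩
      have h1 := hHolder x hx _ hz
      have h2 : ⟪gradient f (x + t • v), v⟫_ℝ - ⟪gradient f x, v⟫_ℝ
          ≤ ‖gradient f (x + t • v) - gradient f x‖ * ‖v‖ := by
        rw [← inner_sub_left]; exact real_inner_le_norm _ _
      have h3 : ‖x + t • v - x‖ ^ ν = t ^ ν * ‖v‖ ^ ν := by
        rw [add_sub_cancel_left, norm_smul, Real.norm_of_nonneg ht.1.le,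
          Real.mul_rpow ht.1.le (norm_nonneg _)]
      have h4 : ‖v‖ ^ (1 + ν) = ‖v‖ * ‖v‖ ^ ν := by
        rw [Real.rpow_add_of_nonneg (norm_nonneg _) (by norm_num) hν.le, Real.rpow_one]
      have h5 : L / (1 + ν) * ‖v‖ ^ (1 + ν) * ((1 + ν) * t ^ ν)
          = L * (t ^ ν * ‖v‖ ^ ν) * ‖v‖ := by
        rw [h4]; field_simp
      rw [h5]
      rw [h3] at h1
      have := mul_le_mul_of_nonneg_right h1 (norm_nonneg v)
      linarith
  have := hanti (Set.left_mem_Icc.2 zero_le_one) (Set.right_mem_Icc.2 zero_le_one) zero_le_one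
  simp only [h, one_smul, zero_smul, add_zero, Real.one_rpow, zero_mul, one_mul, mul_one,
    Real.zero_rpow (by linarith : 1 + ν ≠ 0), mul_zero, sub_zero] at this
  rw [show x + v = y by rw [hv]; abel] at this
  linarith

/-- Nonexpansiveness from the variational characterization. -/
lemma spg_nonexp {d : ℕ} {𝒳 : Set (EuclideanSpace ℝ (Fin d))}
    {u w p q : EuclideanSpace ℝ (Fin d)} (hp : p ∈ 𝒳) (hq : q ∈ 𝒳)
    (h1 : ∀ y ∈ 𝒳, ⟪u - p, y - p⟫_ℝ ≤ 0) (h2 : ∀ y ∈ 𝒳, ⟪w - q, y - q⟫_ℝ ≤ 0) :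
    ‖p - q‖ ≤ ‖u - w‖ := by
  have a := h1 q hq
  have b := h2 p hp
  have e : ⟪u - w, p - q⟫_ℝ = ⟪p - q, p - q⟫_ℝ - ⟪u - p, q - p⟫_ℝ - ⟪w - q, p - q⟫_ℝ := by
    simp only [inner_sub_left, inner_sub_right]; ring
  have c := real_inner_le_norm (u - w) (p - q)
  rw [real_inner_self_eq_norm_sq] at e
  by_contra! hlt
  nlinarith [norm_nonneg (u - w), norm_nonneg (p - q)]

/-- Pointwise one-step inequality. -/
lemma spg_step {d : ℕ} {𝒳 : Set (EuclideanSpace ℝ (Fin d))} (h𝒳conv : Convex ℝ 𝒳)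
    {ν : ℝ} (hν : 0 < ν) {L : ℝ} (hL : 0 < L)
    (f : EuclideanSpace ℝ (Fin d) → ℝ) (hf : Differentiable ℝ f)
    (hHolder : ∀ x ∈ 𝒳, ∀ y ∈ 𝒳, ‖gradient f y - gradient f x‖ ≤ L * ‖y - x‖ ^ ν)
    {γ : ℝ} (hγ : 0 < γ) {x x' G p : EuclideanSpace ℝ (Fin d)}
    (hx : x ∈ 𝒳) (hx' : x' ∈ 𝒳) (hp : p ∈ 𝒳)
    (h1 : ∀ y ∈ 𝒳, ⟪(x - γ • G) - x', y - x'⟫_ℝ ≤ 0)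
    (h2 : ∀ y ∈ 𝒳, ⟪(x - γ • gradient f x) - p, y - p⟫_ℝ ≤ 0) :
    γ * ‖γ⁻¹ • (x - x')‖ ^ 2 ≤ f x - f x' + (⟪x - p, G - gradient f x⟫_ℝ
      + γ * ‖gradient f x - G‖ ^ 2 + L / (1 + ν) * γ ^ (1 + ν) * ‖G‖ ^ (1 + ν)) := by
  have hself : ∀ y ∈ 𝒳, ⟪x - x, y - x⟫_ℝ ≤ 0 := by simp
  have n1 : ‖x' - x‖ ≤ γ * ‖G‖ := by
    have := spg_nonexp hx' hx h1 hself
    rwa [sub_sub_cancel_left, norm_neg, norm_smul, Real.norm_of_nonneg hγ.le] at this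
  have n2 : ‖p - x'‖ ≤ γ * ‖gradient f x - G‖ := by
    have := spg_nonexp hp hx' h2 h1
    rw [sub_sub_sub_cancel_left, ← smul_sub, norm_smul, Real.norm_of_nonneg hγ.le,
      norm_sub_rev G] at this
    exact this
  have n3 : ‖x' - x‖ ^ (1 + ν) ≤ γ ^ (1 + ν) * ‖G‖ ^ (1 + ν) := by
    rw [← Real.mul_rpow hγ.le (norm_nonneg _)]
    exact Real.rpow_le_rpow (norm_nonneg _) n1 (by linarith)
  have n4 := mul_le_mul_of_nonneg_left n3 (show 0 ≤ L / (1 + ν) by positivity)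
  have de := spg_descent h𝒳conv hν f hf hHolder hx hx'
  have a := h1 x hx
  have b := real_inner_le_norm (p - x') (G - gradient f x)
  have b' : ‖p - x'‖ * ‖G - gradient f x‖ ≤ γ * ‖gradient f x - G‖ ^ 2 := by
    rw [norm_sub_rev G]
    nlinarith [norm_nonneg (gradient f x - G)]
  have e1 : γ * ‖γ⁻¹ • (x - x')‖ ^ 2 = γ⁻¹ * ⟪x - x', x - x'⟫_ℝ := by
    rw [norm_smul, Real.norm_of_nonneg (inv_pos.2 hγ).le, real_inner_self_eq_norm_sq]
    field_simp
  have e2 : ⟪x - γ • G - x', x - x'⟫_ℝ = ⟪x - x', x - x'⟫_ℝ - γ * ⟪G, x - x'⟫_ℝ := by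
    rw [show x - γ • G - x' = (x - x') - γ • G by abel, inner_sub_left, real_inner_smul_left]
  have e3 : γ⁻¹ * ⟪x - x', x - x'⟫_ℝ ≤ ⟪G, x - x'⟫_ℝ := by
    rw [inv_mul_le_iff₀ hγ]; linarith
  have e4 : ⟪G, x - x'⟫_ℝ = - ⟪gradient f x, x' - x⟫_ℝ + ⟪x - p, G - gradient f x⟫_ℝ
      + ⟪p - x', G - gradient f x⟫_ℝ := by
    rw [add_assoc, ← inner_add_left, sub_add_sub_cancel, ← inner_neg_right, neg_sub,
      real_inner_comm (G - gradient f x), ← inner_add_left, add_sub_cancel]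
  rw [e1]
  linarith

/-- Expected weighted-sum bound for the mini-batch stochastic projected gradient method
(Lemma: Σ γ_k E‖g̃_k‖² ≤ Δ + σ² Σ γ_k/m_k + (Lσ^(1+ν)/(1+ν)) Σ γ_k^(1+ν)). -/
theorem spg_weighted_sum_bound
    {Ω : Type*} {m0 : MeasurableSpace Ω} (P : Measure Ω) [IsProbabilityMeasure P]
    {d : ℕ} (𝒳 : Set (EuclideanSpace ℝ (Fin d)))
    (h𝒳ne : 𝒳.Nonempty) (h𝒳closed : IsClosed 𝒳) (h𝒳conv : Convex ℝ 𝒳)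
    (ν : ℝ) (hν : ν ∈ Set.Ioc (0 : ℝ) 1) (L : ℝ) (hL : 0 < L) (σ : ℝ) (hσ : 0 < σ)
    (f : EuclideanSpace ℝ (Fin d) → ℝ) (hf : Differentiable ℝ f)
    (hHolder : ∀ x ∈ 𝒳, ∀ y ∈ 𝒳, ‖gradient f y - gradient f x‖ ≤ L * ‖y - x‖ ^ ν)
    (fstar : ℝ) (hfstar : ∀ x ∈ 𝒳, fstar ≤ f x)
    (ℱ : Filtration ℕ m0)
    (γ : ℕ → ℝ) (hγ : ∀ k, 0 < γ k)
    (mb : ℕ → ℕ) (hmb : ∀ k, 1 ≤ mb k)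
    (x G : ℕ → Ω → EuclideanSpace ℝ (Fin d))
    (x0 : EuclideanSpace ℝ (Fin d)) (hx0 : ∀ ω, x 0 ω = x0)
    (hxmeas : ∀ k, Measurable[ℱ k] (x k))
    (hxmem : ∀ k ω, x k ω ∈ 𝒳)
    (hGint : ∀ k, Integrable (G k) P)
    (hGcond : ∀ k, P[G k|ℱ k] =ᵐ[P] fun ω => gradient f (x k ω))
    (hGvarInt : ∀ k, Integrable (fun ω => ‖gradient f (x k ω) - G k ω‖ ^ 2) P)
    (hGvar : ∀ k, ∫ ω, ‖gradient f (x k ω) - G k ω‖ ^ 2 ∂P ≤ σ ^ 2 / mb k)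
    (hGmomInt : ∀ k, Integrable (fun ω => ‖G k ω‖ ^ (1 + ν)) P)
    (hGmom : ∀ k, ∫ ω, ‖G k ω‖ ^ (1 + ν) ∂P ≤ σ ^ (1 + ν))
    (hproj : ∀ k, ∀ᵐ ω ∂P,
      ∀ y ∈ 𝒳, ⟪(x k ω - γ k • G k ω) - x (k + 1) ω, y - x (k + 1) ω⟫_ℝ ≤ 0)
    (N : ℕ) (hN : 1 ≤ N) :
    ∑ k ∈ Finset.range N, γ k * ∫ ω, ‖(γ k)⁻¹ • (x k ω - x (k + 1) ω)‖ ^ 2 ∂P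
      ≤ (f x0 - fstar) + σ ^ 2 * ∑ k ∈ Finset.range N, γ k / mb k
        + L * σ ^ (1 + ν) / (1 + ν) * ∑ k ∈ Finset.range N, γ k ^ (1 + ν) := by
  obtain ⟨hν0, hν1⟩ := hν
  -- projection map
  have hex : ∀ u, ∃ v ∈ 𝒳, ∀ w ∈ 𝒳, ⟪u - v, w - v⟫_ℝ ≤ 0 := by
    intro u
    obtain ⟨v, hv, h⟩ := exists_norm_eq_iInf_of_complete_convex h𝒳ne h𝒳closed.isComplete h𝒳conv u
    exact ⟨v, hv, (norm_eq_iInf_iff_real_inner_le_zero h𝒳conv hv).1 h⟩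
  choose pr hprmem hpr using hex
  have hprlip : LipschitzWith 1 pr := LipschitzWith.of_dist_le_mul fun u w => by
    simpa [dist_eq_norm] using spg_nonexp (hprmem u) (hprmem w) (hpr u) (hpr w)
  have hgm : Measurable (gradient f) := by
    have : gradient f = fun x => (toDual ℝ (EuclideanSpace ℝ (Fin d))).symm (fderiv ℝ f x) := rfl
    rw [this]
    exact (toDual ℝ (EuclideanSpace ℝ (Fin d))).symm.continuous.measurable.comp
      (measurable_fderiv ℝ f)
  have hxm : ∀ k, Measurable (x k) := fun k => (hxmeas k).mono (ℱ.le k) le_rfl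
  have hgxm : ∀ k, AEStronglyMeasurable (fun ω => gradient f (x k ω)) P := fun k =>
    (hgm.comp (hxm k)).aestronglyMeasurable
  have hvar2 : ∀ k, MemLp (fun ω => gradient f (x k ω) - G k ω) 2 P := fun k =>
    (memLp_two_iff_integrable_sq_norm ((hgxm k).sub (hGint k).1)).2 (hGvarInt k)
  have hself : ∀ z : EuclideanSpace ℝ (Fin d), ∀ y ∈ 𝒳, ⟪z - z, y - z⟫_ℝ ≤ 0 := by simp
  -- step of the iterates in L2 once the gradient is
  have hdiff : ∀ k, MemLp (fun ω => gradient f (x k ω)) 2 P →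
      MemLp (fun ω => x (k + 1) ω - x k ω) 2 P := by
    intro k hk
    have hG2 : MemLp (fun ω => G k ω) 2 P := by
      have := hk.sub (hvar2 k)
      refine this.congr_norm (hGint k).1 (Filter.Eventually.of_forall fun ω => ?_)
      simp
    refine hG2.of_le_mul (c := γ k) ((hxm (k+1)).sub (hxm k)).aestronglyMeasurable ?_
    filter_upwards [hproj k] with ω hω
    have := spg_nonexp (hxmem (k+1) ω) (hxmem k ω) hω (hself (x k ω))
    rwa [sub_sub_cancel_left, norm_neg, norm_smul, Real.norm_of_nonneg (hγ k).le] at this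
  have hg2 : ∀ k, MemLp (fun ω => gradient f (x k ω)) 2 P := by
    intro k
    induction k with
    | zero => simp only [hx0]; exact memLp_const _
    | succ k ih =>
      have hb : MemLp (fun ω => ‖gradient f (x k ω)‖ + L * (1 + ‖x (k + 1) ω - x k ω‖)) 2 P :=
        ih.norm.add (((memLp_const (1:ℝ)).add (hdiff k ih).norm).const_mul L)
      refine hb.mono' (hgxm (k+1)) (Filter.Eventually.of_forall fun ω => ?_)
      have h1 := hHolder _ (hxmem k ω) _ (hxmem (k+1) ω)
      have h2 : ‖x (k + 1) ω - x k ω‖ ^ ν ≤ 1 + ‖x (k + 1) ω - x k ω‖ := by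
        have hn := norm_nonneg (x (k + 1) ω - x k ω)
        calc _ ≤ (1 + ‖x (k + 1) ω - x k ω‖) ^ ν :=
              Real.rpow_le_rpow hn (by linarith) hν0.le
          _ ≤ (1 + ‖x (k + 1) ω - x k ω‖) ^ (1:ℝ) :=
              Real.rpow_le_rpow_of_exponent_le (by linarith) hν1
          _ = _ := Real.rpow_one _
      have h3 := norm_le_norm_add_norm_sub (gradient f (x k ω)) (gradient f (x (k+1) ω))
      have h4 := mul_le_mul_of_nonneg_left h2 hL.le
      have h5 := norm_sub_rev (gradient f (x k ω)) (gradient f (x (k+1) ω))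
      linarith
  -- the deterministic projected step
  let q : ℕ → Ω → EuclideanSpace ℝ (Fin d) :=
    fun k ω => x k ω - pr (x k ω - γ k • gradient f (x k ω))
  have hqm : ∀ k, Measurable[ℱ k] (q k) := by
    intro k
    have hb : Measurable (fun z => z - pr (z - γ k • gradient f z)) :=
      measurable_id.sub (hprlip.continuous.measurable.comp
        (measurable_id.sub (hgm.const_smul (γ k) : Measurable fun z => γ k • gradient f z)))
    exact hb.comp (hxmeas k)
  have hq2 : ∀ k, MemLp (q k) 2 P := by
    intro k
    refine (hg2 k).of_le_mul (c := γ k)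
      ((hqm k).mono (ℱ.le k) le_rfl).aestronglyMeasurable (Filter.Eventually.of_forall fun ω => ?_)
    have := spg_nonexp (hxmem k ω) (hprmem _) (hself (x k ω))
      (hpr (x k ω - γ k • gradient f (x k ω)))
    rwa [sub_sub_cancel, norm_smul, Real.norm_of_nonneg (hγ k).le] at this
  have hδ2 : ∀ k, MemLp (fun ω => G k ω - gradient f (x k ω)) 2 P := fun k => by
    refine (hvar2 k).neg.congr_norm ((hGint k).1.sub (hgxm k))
      (Filter.Eventually.of_forall fun ω => ?_)
    simp
  have hqδ : ∀ k, Integrable (fun ω => ⟪q k ω, G k ω - gradient f (x k ω)⟫_ℝ) P := by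
    intro k
    refine ((hq2 k).norm.integrable_mul (hδ2 k).norm).mono'
      ((hq2 k).1.inner (hδ2 k).1) (Filter.Eventually.of_forall fun ω => ?_)
    exact norm_inner_le_norm _ _
  have hqδ0 : ∀ k, ∫ ω, ⟪q k ω, G k ω - gradient f (x k ω)⟫_ℝ ∂P = 0 := by
    intro k
    have hgi : Integrable (fun ω => gradient f (x k ω)) P := (hg2 k).integrable (by norm_num)
    have h1 := condExp_bilin_of_stronglyMeasurable_left (m := ℱ k) (μ := P)
      (innerSL ℝ (E := EuclideanSpace ℝ (Fin d))) (f := q k)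
      (g := fun ω => G k ω - gradient f (x k ω)) (hqm k).stronglyMeasurable
      (hqδ k) ((hGint k).sub hgi)
    have h2 : P[fun ω => G k ω - gradient f (x k ω)|ℱ k] =ᵐ[P] 0 := by
      have a := condExp_sub (hGint k) hgi (ℱ k)
      have b : P[fun ω => gradient f (x k ω)|ℱ k] = fun ω => gradient f (x k ω) :=
        condExp_of_stronglyMeasurable (ℱ.le k) (hgm.comp (hxmeas k)).stronglyMeasurable hgi
      rw [b] at a
      refine Filter.EventuallyEq.trans a ?_
      filter_upwards [hGcond k] with ω hω
      simp [hω]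
    rw [← integral_condExp (ℱ.le k)]
    refine integral_eq_zero_of_ae (Filter.EventuallyEq.trans h1 ?_)
    filter_upwards [h2] with ω hω
    simp [hω]
  let W : ℕ → Ω → ℝ := fun k ω => ⟪q k ω, G k ω - gradient f (x k ω)⟫_ℝ
      + γ k * ‖gradient f (x k ω) - G k ω‖ ^ 2
      + L / (1 + ν) * γ k ^ (1 + ν) * ‖G k ω‖ ^ (1 + ν)
  have hWi : ∀ k, Integrable (W k) P := fun k =>
    ((hqδ k).add ((hGvarInt k).const_mul _)).add ((hGmomInt k).const_mul _)
  have hWb : ∀ k, ∫ ω, W k ω ∂P ≤ σ ^ 2 * (γ k / mb k)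
      + L * σ ^ (1 + ν) / (1 + ν) * γ k ^ (1 + ν) := by
    intro k
    have e : ∫ ω, W k ω ∂P = ∫ ω, ⟪q k ω, G k ω - gradient f (x k ω)⟫_ℝ ∂P
      + γ k * ∫ ω, ‖gradient f (x k ω) - G k ω‖ ^ 2 ∂P
      + L / (1 + ν) * γ k ^ (1 + ν) * ∫ ω, ‖G k ω‖ ^ (1 + ν) ∂P := by
      rw [← integral_const_mul, ← integral_const_mul, ← integral_add (hqδ k)
        ((hGvarInt k).const_mul _)]
      exact integral_add ((hqδ k).add ((hGvarInt k).const_mul _)) ((hGmomInt k).const_mul _)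
    rw [e, hqδ0 k]
    have a := mul_le_mul_of_nonneg_left (hGvar k) (hγ k).le
    have hγp : 0 < γ k ^ (1 + ν) := Real.rpow_pos_of_pos (hγ k) _
    have b := mul_le_mul_of_nonneg_left (hGmom k)
      (show 0 ≤ L / (1 + ν) * γ k ^ (1 + ν) by positivity)
    have c1 : γ k * (σ ^ 2 / mb k) = σ ^ 2 * (γ k / mb k) := by ring
    have c2 : L / (1 + ν) * γ k ^ (1 + ν) * σ ^ (1 + ν)
      = L * σ ^ (1 + ν) / (1 + ν) * γ k ^ (1 + ν) := by ring
    linarith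
  have hstep : ∀ k, ∀ᵐ ω ∂P, γ k * ‖(γ k)⁻¹ • (x k ω - x (k + 1) ω)‖ ^ 2
      ≤ f (x k ω) - f (x (k + 1) ω) + W k ω := by
    intro k
    filter_upwards [hproj k] with ω hω
    exact spg_step h𝒳conv hν0 hL f hf hHolder (hγ k) (hxmem k ω) (hxmem (k+1) ω)
      (hprmem _) hω (hpr _)
  have hfi : ∀ k, Integrable (fun ω => f (x k ω)) P := by
    intro k
    induction k with
    | zero => simp only [hx0]; exact integrable_const _
    | succ k ih =>
      have hb : Integrable (fun ω => |f (x k ω) + W k ω| + |fstar|) P :=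
        (ih.add (hWi k)).abs.add (integrable_const _)
      refine hb.mono' (hf.continuous.measurable.comp (hxm (k+1))).aestronglyMeasurable ?_
      filter_upwards [hstep k] with ω hω
      have h0 : 0 ≤ γ k * ‖(γ k)⁻¹ • (x k ω - x (k + 1) ω)‖ ^ 2 :=
        mul_nonneg (hγ k).le (sq_nonneg _)
      have h1 := hfstar _ (hxmem (k+1) ω)
      rw [Real.norm_eq_abs, abs_le]
      constructor
      · linarith [neg_abs_le fstar, abs_nonneg (f (x k ω) + W k ω)]
      · linarith [le_abs_self (f (x k ω) + W k ω), abs_nonneg fstar]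
  have hkey : ∀ k, γ k * ∫ ω, ‖(γ k)⁻¹ • (x k ω - x (k + 1) ω)‖ ^ 2 ∂P
      ≤ ∫ ω, f (x k ω) ∂P - ∫ ω, f (x (k + 1) ω) ∂P + (σ ^ 2 * (γ k / mb k)
      + L * σ ^ (1 + ν) / (1 + ν) * γ k ^ (1 + ν)) := by
    intro k
    have hi : Integrable (fun ω => ‖(γ k)⁻¹ • (x k ω - x (k + 1) ω)‖ ^ 2) P := by
      have hm : MemLp (fun ω => (γ k)⁻¹ • (x k ω - x (k + 1) ω)) 2 P := by
        refine ((hdiff k (hg2 k)).const_smul (γ k)⁻¹).congr_norm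
          (((hxm k).sub (hxm (k+1))).const_smul (γ k)⁻¹ :
            Measurable fun ω => (γ k)⁻¹ • (x k ω - x (k + 1) ω)).aestronglyMeasurable
          (Filter.Eventually.of_forall fun ω => ?_)
        simp [norm_smul, norm_sub_rev]
      exact (memLp_two_iff_integrable_sq_norm hm.1).1 hm
    rw [← integral_const_mul]
    have h1 := integral_mono_ae (hi.const_mul (γ k))
      (((hfi k).sub (hfi (k+1))).add (hWi k)) (hstep k)
    have h2 : ∫ ω, (((fun ω => f (x k ω)) - fun ω => f (x (k + 1) ω)) + W k) ω ∂P
        = ∫ ω, f (x k ω) ∂P - ∫ ω, f (x (k + 1) ω) ∂P + ∫ ω, W k ω ∂P := by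
      rw [integral_add' ((hfi k).sub (hfi (k+1))) (hWi k), integral_sub' (hfi k) (hfi (k+1))]
    have h3 := hWb k
    linarith
  have hsum := Finset.sum_le_sum fun k (_ : k ∈ Finset.range N) => hkey k
  rw [Finset.sum_add_distrib, Finset.sum_range_sub', Finset.sum_add_distrib,
    ← Finset.mul_sum, ← Finset.mul_sum] at hsum
  have hf0 : ∫ ω, f (x 0 ω) ∂P = f x0 := by simp [hx0]
  have hfN : fstar ≤ ∫ ω, f (x N ω) ∂P := by
    have := integral_mono (μ := P) (integrable_const fstar) (hfi N)
      (fun ω => hfstar _ (hxmem N ω))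
    simpa using this
  linarith
end

section
/- Let 𝒳 ⊆ ℝ^d be a nonempty closed convex set, ν ∈ (0, 1], L > 0, σ > 0, γ̃ > 0, m̃ > 0, and let f : ℝ^d → ℝ be differentiable with ‖∇f(y) − ∇f(x)‖ ≤ L‖y − x‖^ν for all x, y ∈ 𝒳 and f ≥ f* on 𝒳. On a probability space with filtration (𝓕_k), let the stepsizes and batch sizes be γ_k = γ̃/(1+k)^{1/(1+ν)} and m_k = ⌈ m̃ (1+k)^{ν/(1+ν)} ⌉, let x_0 ∈ 𝒳 be deterministic, and let (x_k), (G_k) be random sequences in ℝ^d with: x_k 𝓕_k-measurable with values in 𝒳; E[G_k | 𝓕_k] = ∇f(x_k) a.s.; E[‖∇f(x_k) − G_k‖²] ≤ σ²/m_k; E[‖G_k‖^{1+ν}] ≤ σ^{1+ν}; and x_{k+1} almost surely the Euclidean projection of x_k − γ_k G_k onto 𝒳. Then there exists a constant C > 0 such that for all N ≥ 2, min_{k=0,…,N−1} E[ dist(0, ∇f(x_{k+1}) + N_𝒳(x_{k+1})) ] ≤ C · √( (log N) / N^{ν/(1+ν)} ). -/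
open MeasureTheory InnerProductSpace

lemma spg_delta {E : Type*} [NormedAddCommGroup E] [InnerProductSpace ℝ E]
    {a b G : E} {γ : ℝ} (hγ : 0 < γ)
    (h : ⟪(a - γ • G) - b, a - b⟫_ℝ ≤ 0) :
    ‖b - a‖ ^ 2 ≤ - (γ * ⟪G, b - a⟫_ℝ) ∧ ‖b - a‖ ≤ γ * ‖G‖ := by
  have h1 : (a - γ • G) - b = - (b - a) - γ • G := by abel
  have h2 : a - b = - (b - a) := by abel
  rw [h1, h2, inner_neg_right, inner_sub_left, inner_neg_left, inner_smul_left,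
    real_inner_self_eq_norm_sq] at h
  simp only [conj_trivial] at h
  have h3 : ‖b - a‖ ^ 2 ≤ - (γ * ⟪G, b - a⟫_ℝ) := by linarith
  refine ⟨h3, ?_⟩
  have h4 : - ⟪G, b - a⟫_ℝ ≤ ‖G‖ * ‖b - a‖ := by
    have := abs_real_inner_le_norm G (b - a)
    have := neg_abs_le ⟪G, b - a⟫_ℝ
    linarith
  by_contra hc
  push Not at hc
  have h5 : 0 < ‖b - a‖ := lt_of_le_of_lt (by positivity) hc
  nlinarith [mul_le_mul_of_nonneg_left h4 hγ.le, mul_lt_mul_of_pos_right hc h5]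

lemma spg_descent_s16 {E : Type*} [NormedAddCommGroup E] [InnerProductSpace ℝ E] [CompleteSpace E]
    {X : Set E} (hX : Convex ℝ X) {ν L : ℝ} (hν : 0 < ν) (hL : 0 < L)
    {f : E → ℝ} (hf : Differentiable ℝ f)
    (hH : ∀ x ∈ X, ∀ y ∈ X, ‖gradient f y - gradient f x‖ ≤ L * ‖y - x‖ ^ ν)
    {a b : E} (ha : a ∈ X) (hb : b ∈ X) :
    f b ≤ f a + ⟪gradient f a, b - a⟫_ℝ + L * ‖b - a‖ ^ (1 + ν) := by
  obtain ⟨z, hz, hz'⟩ := domain_mvt (f := f) (s := Set.univ) (x := a) (y := b)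
    (f' := fun z => fderiv ℝ f z)
    (fun z _ => (hf z).hasFDerivAt.hasFDerivWithinAt) convex_univ
    (Set.mem_univ _) (Set.mem_univ _)
  have hzX : z ∈ X := hX.segment_subset ha hb hz
  have e1 : fderiv ℝ f z (b - a) = ⟪gradient f z, b - a⟫_ℝ := by
    rw [gradient, InnerProductSpace.toDual_symm_apply]
  have hza : ‖z - a‖ ≤ ‖b - a‖ := by
    obtain ⟨t, ht, rfl⟩ := (segment_eq_image' ℝ a b) ▸ hz
    simp only [add_sub_cancel_left, norm_smul, Real.norm_eq_abs, abs_of_nonneg ht.1]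
    nlinarith [ht.2, norm_nonneg (b - a)]
  have h2 : ⟪gradient f z - gradient f a, b - a⟫_ℝ ≤ L * ‖b - a‖ ^ ν * ‖b - a‖ := by
    refine (real_inner_le_norm _ _).trans ?_
    refine mul_le_mul_of_nonneg_right ((hH a ha z hzX).trans ?_) (norm_nonneg _)
    gcongr
  rw [inner_sub_left] at h2
  have h3 : ‖b - a‖ ^ (1 + ν) = ‖b - a‖ ^ ν * ‖b - a‖ := by
    rw [Real.rpow_add_of_nonneg (norm_nonneg _) zero_le_one hν.le, Real.rpow_one, mul_comm]
  rw [h3]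
  rw [e1] at hz'
  linarith

lemma spg_pt {E : Type*} [NormedAddCommGroup E] [InnerProductSpace ℝ E] [CompleteSpace E]
    {X : Set E} (hX : Convex ℝ X) {ν L : ℝ} (hν : 0 < ν) (hL : 0 < L)
    {f : E → ℝ} (hf : Differentiable ℝ f)
    (hH : ∀ x ∈ X, ∀ y ∈ X, ‖gradient f y - gradient f x‖ ≤ L * ‖y - x‖ ^ ν)
    {a b G : E} {γ : ℝ} (hγ : 0 < γ) (ha : a ∈ X) (hb : b ∈ X)
    (h : ∀ y ∈ X, ⟪(a - γ • G) - b, y - b⟫_ℝ ≤ 0) :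
    ‖b - a‖ ^ 2 / (2 * γ) ≤ f a - f b + γ / 2 * ‖gradient f a - G‖ ^ 2
      + L * γ ^ (1 + ν) * ‖G‖ ^ (1 + ν) := by
  obtain ⟨h1, h2⟩ := spg_delta hγ (h a ha)
  have h3 := spg_descent_s16 hX hν hL hf hH ha hb
  have h4 : ‖b - a‖ ^ (1 + ν) ≤ γ ^ (1 + ν) * ‖G‖ ^ (1 + ν) := by
    rw [← Real.mul_rpow hγ.le (norm_nonneg _)]
    gcongr
  have h5 : ⟪gradient f a - G, b - a⟫_ℝ ≤ ‖gradient f a - G‖ * ‖b - a‖ := real_inner_le_norm _ _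
  rw [inner_sub_left] at h5
  have h6 : ‖b - a‖ ^ 2 / γ ≤ - ⟪G, b - a⟫_ℝ := by
    rw [div_le_iff₀ hγ]; linarith
  have h7 : ‖gradient f a - G‖ * ‖b - a‖ ≤
      γ / 2 * ‖gradient f a - G‖ ^ 2 + ‖b - a‖ ^ 2 / (2 * γ) := by
    have : γ / 2 * ‖gradient f a - G‖ ^ 2 + ‖b - a‖ ^ 2 / (2 * γ)
      - ‖gradient f a - G‖ * ‖b - a‖ = (γ * ‖gradient f a - G‖ - ‖b - a‖) ^ 2 / (2 * γ) := by
      field_simp; ring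
    have : 0 ≤ (γ * ‖gradient f a - G‖ - ‖b - a‖) ^ 2 / (2 * γ) := by positivity
    linarith
  have h8 : ‖b - a‖ ^ 2 / γ = 2 * (‖b - a‖ ^ 2 / (2 * γ)) := by field_simp
  have h9 := mul_le_mul_of_nonneg_left h4 hL.le
  linarith

lemma spg_dist {E : Type*} [NormedAddCommGroup E] [InnerProductSpace ℝ E] [CompleteSpace E]
    {X : Set E} (hX : Convex ℝ X) {ν L : ℝ} (hν : 0 < ν) (hν1 : ν ≤ 1) (hL : 0 < L)
    {f : E → ℝ} (hf : Differentiable ℝ f)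
    (hH : ∀ x ∈ X, ∀ y ∈ X, ‖gradient f y - gradient f x‖ ≤ L * ‖y - x‖ ^ ν)
    {a b G : E} {γ : ℝ} (hγ : 0 < γ) (ha : a ∈ X) (hb : b ∈ X)
    (h : ∀ y ∈ X, ⟪(a - γ • G) - b, y - b⟫_ℝ ≤ 0) :
    γ * Metric.infDist (0 : E)
          {v | ∃ u, (∀ y ∈ X, ⟪u, y - b⟫_ℝ ≤ 0) ∧ v = gradient f b + u} ^ 2 ≤
      6 * (f a - f b) + 6 * γ * ‖gradient f a - G‖ ^ 2
      + (3 * L ^ 2 * γ ^ (1 + 2 * ν) * (1 + ‖G‖ ^ (1 + ν))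
        + 6 * L * γ ^ (1 + ν) * ‖G‖ ^ (1 + ν)) := by
  have h0 := spg_pt hX hν hL hf hH hγ ha hb h
  obtain ⟨-, h2⟩ := spg_delta hγ (h a ha)
  set D := Metric.infDist (0 : E)
          {v | ∃ u, (∀ y ∈ X, ⟪u, y - b⟫_ℝ ≤ 0) ∧ v = gradient f b + u} with hD
  have hD0 : 0 ≤ D := Metric.infDist_nonneg
  have hD1 : D ≤ ‖gradient f b + γ⁻¹ • ((a - γ • G) - b)‖ := by
    have := Metric.infDist_le_dist_of_mem (x := (0 : E))
      (s := {v | ∃ u, (∀ y ∈ X, ⟪u, y - b⟫_ℝ ≤ 0) ∧ v = gradient f b + u})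
      (y := gradient f b + γ⁻¹ • ((a - γ • G) - b)) ⟨_, fun y hy => by
        rw [inner_smul_left]
        exact mul_nonpos_of_nonneg_of_nonpos (by simpa using hγ.le) (h y hy), rfl⟩
    rwa [dist_zero_left] at this
  have e1 : gradient f b + γ⁻¹ • ((a - γ • G) - b) =
      (gradient f b - gradient f a) + (gradient f a - G) + (- (γ⁻¹ • (b - a))) := by
    have : γ⁻¹ • ((a - γ • G) - b) = - (γ⁻¹ • (b - a)) - G := by
      rw [show (a - γ • G) - b = - (b - a) - γ • G by abel, smul_sub, smul_neg,
        inv_smul_smul₀ hγ.ne']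
    rw [this]; abel
  have hD2 : D ≤ L * (γ * ‖G‖) ^ ν + ‖gradient f a - G‖ + ‖b - a‖ / γ := by
    rw [e1] at hD1
    refine hD1.trans ((norm_add₃_le).trans ?_)
    have n1 : ‖- (γ⁻¹ • (b - a))‖ = ‖b - a‖ / γ := by
      rw [norm_neg, norm_smul, norm_inv, Real.norm_eq_abs, abs_of_pos hγ]; ring
    rw [n1]
    have n2 : ‖gradient f b - gradient f a‖ ≤ L * (γ * ‖G‖) ^ ν := by
      refine (hH a ha b hb).trans ?_
      gcongr
    linarith
  set A := L * (γ * ‖G‖) ^ ν with hA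
  set B := ‖gradient f a - G‖
  have hA2 : γ * A ^ 2 ≤ L ^ 2 * γ ^ (1 + 2 * ν) * (1 + ‖G‖ ^ (1 + ν)) := by
    have hg : γ ^ (1 + 2 * ν) = γ * (γ ^ ν) ^ 2 := by
      rw [Real.rpow_add hγ, Real.rpow_one, mul_comm 2 ν, Real.rpow_mul hγ.le, Real.rpow_two]
    have hG2 : (‖G‖ ^ ν) ^ 2 ≤ 1 + ‖G‖ ^ (1 + ν) := by
      have hn := norm_nonneg G
      rw [← Real.rpow_two, ← Real.rpow_mul hn]
      rcases le_total ‖G‖ 1 with h1 | h1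
      · have := Real.rpow_le_one hn h1 (show 0 ≤ ν * 2 by linarith)
        have : 0 ≤ ‖G‖ ^ (1 + ν) := by positivity
        linarith
      · have := Real.rpow_le_rpow_of_exponent_le h1 (show ν * 2 ≤ 1 + ν by linarith)
        linarith
    rw [hA, Real.mul_rpow hγ.le (norm_nonneg _), hg]
    calc γ * (L * (γ ^ ν * ‖G‖ ^ ν)) ^ 2 = L ^ 2 * (γ * (γ ^ ν) ^ 2) * (‖G‖ ^ ν) ^ 2 := by ring
      _ ≤ _ := by gcongr
  have hD3 : D ^ 2 ≤ 3 * (A ^ 2 + B ^ 2 + (‖b - a‖ / γ) ^ 2) := by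
    have : D ^ 2 ≤ (A + B + ‖b - a‖ / γ) ^ 2 := by gcongr
    nlinarith [sq_nonneg (A - B), sq_nonneg (A - ‖b - a‖ / γ), sq_nonneg (B - ‖b - a‖ / γ)]
  have hD4 := mul_le_mul_of_nonneg_left hD3 hγ.le
  have e2 : γ * (‖b - a‖ / γ) ^ 2 = 2 * (‖b - a‖ ^ 2 / (2 * γ)) := by field_simp
  nlinarith

/-- Rate corollary: with stepsizes γ_k = γ̃/(1+k)^(1/(1+ν)) and batch sizes
m_k = ⌈m̃ (1+k)^(ν/(1+ν))⌉, the mini-batch stochastic projected gradient method satisfies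
min_{k<N} E[dist(0, ∇f(x_{k+1}) + N_𝒳(x_{k+1}))] ≤ C √(log N / N^(ν/(1+ν))). -/
theorem spg_convergence_rate
    {Ω : Type*} {m0 : MeasurableSpace Ω} (P : Measure Ω) [IsProbabilityMeasure P]
    {d : ℕ} (𝒳 : Set (EuclideanSpace ℝ (Fin d)))
    (h𝒳ne : 𝒳.Nonempty) (h𝒳closed : IsClosed 𝒳) (h𝒳conv : Convex ℝ 𝒳)
    (ν : ℝ) (hν : ν ∈ Set.Ioc (0 : ℝ) 1) (L : ℝ) (hL : 0 < L) (σ : ℝ) (hσ : 0 < σ)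
    (γtilde : ℝ) (hγtilde : 0 < γtilde) (mtilde : ℝ) (hmtilde : 0 < mtilde)
    (f : EuclideanSpace ℝ (Fin d) → ℝ) (hf : Differentiable ℝ f)
    (hHolder : ∀ x ∈ 𝒳, ∀ y ∈ 𝒳, ‖gradient f y - gradient f x‖ ≤ L * ‖y - x‖ ^ ν)
    (fstar : ℝ) (hfstar : ∀ x ∈ 𝒳, fstar ≤ f x)
    (ℱ : Filtration ℕ m0)
    (γ : ℕ → ℝ) (hγdef : ∀ k, γ k = γtilde / ((1 : ℝ) + k) ^ (1 / (1 + ν)))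
    (mb : ℕ → ℕ) (hmbdef : ∀ k, mb k = ⌈mtilde * ((1 : ℝ) + k) ^ (ν / (1 + ν))⌉₊)
    (x G : ℕ → Ω → EuclideanSpace ℝ (Fin d))
    (x0 : EuclideanSpace ℝ (Fin d)) (hx0 : ∀ ω, x 0 ω = x0)
    (hxmeas : ∀ k, Measurable[ℱ k] (x k))
    (hxmem : ∀ k ω, x k ω ∈ 𝒳)
    (hGint : ∀ k, Integrable (G k) P)
    (hGcond : ∀ k, P[G k|ℱ k] =ᵐ[P] fun ω => gradient f (x k ω))
    (hGvarInt : ∀ k, Integrable (fun ω => ‖gradient f (x k ω) - G k ω‖ ^ 2) P)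
    (hGvar : ∀ k, ∫ ω, ‖gradient f (x k ω) - G k ω‖ ^ 2 ∂P ≤ σ ^ 2 / mb k)
    (hGmomInt : ∀ k, Integrable (fun ω => ‖G k ω‖ ^ (1 + ν)) P)
    (hGmom : ∀ k, ∫ ω, ‖G k ω‖ ^ (1 + ν) ∂P ≤ σ ^ (1 + ν))
    (hproj : ∀ k, ∀ᵐ ω ∂P,
      ∀ y ∈ 𝒳, ⟪(x k ω - γ k • G k ω) - x (k + 1) ω, y - x (k + 1) ω⟫_ℝ ≤ 0) :
    ∃ C : ℝ, 0 < C ∧ ∀ N : ℕ, ∀ hN : 2 ≤ N,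
      Finset.inf' (Finset.range N)
        (Finset.nonempty_range_iff.mpr (by omega))
        (fun k => ∫ ω, Metric.infDist (0 : EuclideanSpace ℝ (Fin d))
          {v | ∃ u, (∀ y ∈ 𝒳, ⟪u, y - x (k + 1) ω⟫_ℝ ≤ 0)
            ∧ v = gradient f (x (k + 1) ω) + u} ∂P)
        ≤ C * Real.sqrt (Real.log N / (N : ℝ) ^ (ν / (1 + ν))) := by
  obtain ⟨hν0, hν1⟩ := hν
  have h1ν : 0 < 1 + ν := by linarith
  have hk1 : ∀ k : ℕ, (0 : ℝ) < 1 + k := fun k => by positivity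
  have hγpos : ∀ k, 0 < γ k := fun k => by
    rw [hγdef]; exact div_pos hγtilde (Real.rpow_pos_of_pos (hk1 k) _)
  have hfmeas : ∀ k, Measurable (fun ω => f (x k ω)) := fun k =>
    hf.continuous.measurable.comp ((hxmeas k).mono (ℱ.le k) le_rfl)
  have hfint : ∀ k, Integrable (fun ω => f (x k ω)) P := by
    intro k
    induction k with
    | zero => simp only [hx0]; exact integrable_const _
    | succ k ih =>
      refine integrable_of_le_of_le (hfmeas _).aestronglyMeasurable
        (g₁ := fun _ => fstar) (g₂ := fun ω => f (x k ω) + γ k / 2 * ‖gradient f (x k ω) - G k ω‖ ^ 2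
          + L * γ k ^ (1 + ν) * ‖G k ω‖ ^ (1 + ν)) ?_ ?_ (integrable_const _)
          ((ih.add ((hGvarInt k).const_mul _)).add ((hGmomInt k).const_mul _))
      · exact Filter.Eventually.of_forall fun ω => hfstar _ (hxmem _ _)
      · filter_upwards [hproj k] with ω hω
        have := spg_pt h𝒳conv hν0 hL hf hHolder (hγpos k) (hxmem k ω) (hxmem (k+1) ω) hω
        have h0 : 0 ≤ ‖x (k+1) ω - x k ω‖ ^ 2 / (2 * γ k) := by
          have := hγpos k
          positivity
        linarith
  set D : ℕ → ℝ := fun k => ∫ ω, Metric.infDist (0 : EuclideanSpace ℝ (Fin d))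
          {v | ∃ u, (∀ y ∈ 𝒳, ⟪u, y - x (k + 1) ω⟫_ℝ ≤ 0)
            ∧ v = gradient f (x (k + 1) ω) + u} ∂P with hDdef
  have hD0 : ∀ k, 0 ≤ D k := fun k => integral_nonneg fun ω => Metric.infDist_nonneg
  set F : ℕ → ℝ := fun k => ∫ ω, f (x k ω) ∂P with hFdef
  have hstep : ∀ k, γ k * D k ^ 2 ≤ 6 * (F k - F (k+1)) + 6 * γ k * (σ ^ 2 / mb k)
      + (3 * L ^ 2 * γ k ^ (1 + 2 * ν) * (1 + σ ^ (1 + ν))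
        + 6 * L * γ k ^ (1 + ν) * σ ^ (1 + ν)) := by
    intro k
    have hg := hγpos k
    have i1 := hfint k
    have i2 := hfint (k+1)
    have i3 := hGvarInt k
    have i4 := hGmomInt k
    set W : Ω → ℝ := fun ω => 6 * (f (x k ω) - f (x (k+1) ω))
      + 6 * γ k * ‖gradient f (x k ω) - G k ω‖ ^ 2
      + (3 * L ^ 2 * γ k ^ (1 + 2 * ν) * (1 + ‖G k ω‖ ^ (1 + ν))
        + 6 * L * γ k ^ (1 + ν) * ‖G k ω‖ ^ (1 + ν)) with hW
    have j1 := (i1.sub i2).const_mul 6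
    have j2 := i3.const_mul (6 * γ k)
    have j3 := ((integrable_const (1:ℝ)).add i4).const_mul (3 * L ^ 2 * γ k ^ (1 + 2 * ν))
    have j4 := i4.const_mul (6 * L * γ k ^ (1 + ν))
    have hWi : Integrable W P := (j1.add j2).add (j3.add j4)
    have hWe : ∫ ω, W ω ∂P = 6 * (F k - F (k+1))
        + 6 * γ k * (∫ ω, ‖gradient f (x k ω) - G k ω‖ ^ 2 ∂P)
      + (3 * L ^ 2 * γ k ^ (1 + 2 * ν) * (1 + ∫ ω, ‖G k ω‖ ^ (1 + ν) ∂P)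
        + 6 * L * γ k ^ (1 + ν) * ∫ ω, ‖G k ω‖ ^ (1 + ν) ∂P) := by
      refine (integral_add (j1.add j2) (j3.add j4)).trans ?_
      refine congrArg₂ (· + ·) ((integral_add j1 j2).trans ?_) ((integral_add j3 j4).trans ?_)
      · refine congrArg₂ (· + ·) ?_ (integral_const_mul _ _)
        refine (integral_const_mul _ _).trans ?_
        congr 1
        exact integral_sub i1 i2
      · refine congrArg₂ (· + ·) ?_ (integral_const_mul _ _)
        refine (integral_const_mul _ _).trans ?_
        congr 1
        refine (integral_add (integrable_const (1:ℝ)) i4).trans ?_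
        simp
    have hb : γ k * D k ^ 2 ≤ ∫ ω, W ω ∂P := by
      have hm : ∫ ω, (2 * γ k * D k) * Metric.infDist (0 : EuclideanSpace ℝ (Fin d))
          {v | ∃ u, (∀ y ∈ 𝒳, ⟪u, y - x (k + 1) ω⟫_ℝ ≤ 0)
            ∧ v = gradient f (x (k + 1) ω) + u} ∂P ≤ ∫ ω, (γ k * D k ^ 2 + W ω) ∂P := by
        refine integral_mono_of_nonneg ?_ ((integrable_const _).add hWi) ?_
        · exact Filter.Eventually.of_forall fun ω =>
            mul_nonneg (mul_nonneg (by linarith) (hD0 k)) Metric.infDist_nonneg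
        · filter_upwards [hproj k] with ω hω
          have := spg_dist h𝒳conv hν0 hν1 hL hf hHolder hg (hxmem k ω) (hxmem (k+1) ω) hω
          simp only [hW]
          set q := Metric.infDist (0 : EuclideanSpace ℝ (Fin d))
            {v | ∃ u, (∀ y ∈ 𝒳, ⟪u, y - x (k + 1) ω⟫_ℝ ≤ 0)
            ∧ v = gradient f (x (k + 1) ω) + u}
          nlinarith [mul_nonneg hg.le (sq_nonneg (D k - q))]
      rw [integral_const_mul, integral_add (integrable_const _) hWi] at hm
      simp only [integral_const, probReal_univ, smul_eq_mul, one_mul] at hm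
      change 2 * γ k * D k * D k ≤ _ at hm
      nlinarith
    rw [hWe] at hb
    have k1 := hGvar k
    have k2 := hGmom k
    refine hb.trans ?_
    gcongr
  obtain ⟨K, hK0, hK⟩ : ∃ K : ℝ, 0 ≤ K ∧ ∀ k, γ k * D k ^ 2 ≤ 6 * (F k - F (k+1)) + K * (1 / (1 + k)) := by
    refine ⟨6 * (γtilde * σ ^ 2 / mtilde) + (3 * L ^ 2 * (γtilde ^ ν * γtilde ^ (1 + ν)) * (1 + σ ^ (1 + ν))
        + 6 * L * γtilde ^ (1 + ν) * σ ^ (1 + ν)), by positivity, fun k => ?_⟩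
    have hg := hγpos k
    have g1 : γ k ^ (1 + ν) = γtilde ^ (1 + ν) * (1 / (1 + k)) := by
      rw [hγdef, Real.div_rpow hγtilde.le (by positivity), ← Real.rpow_mul (hk1 k).le,
        one_div_mul_cancel h1ν.ne', Real.rpow_one]; ring
    have g0 : γ k ≤ γtilde := by
      rw [hγdef]
      apply div_le_self hγtilde.le
      apply Real.one_le_rpow
      · have : (0:ℝ) ≤ k := by positivity
        linarith
      · positivity
    have g2 : γ k ^ (1 + 2 * ν) ≤ (γtilde ^ ν * γtilde ^ (1 + ν)) * (1 / (1 + k)) := by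
      rw [show 1 + 2 * ν = ν + (1 + ν) by ring, Real.rpow_add hg, g1, mul_assoc]
      gcongr
    have g3 : γ k * (σ ^ 2 / mb k) ≤ γtilde * σ ^ 2 / mtilde * (1 / (1 + k)) := by
      have hm : mtilde * ((1 : ℝ) + k) ^ (ν / (1 + ν)) ≤ mb k := by
        rw [hmbdef]; exact Nat.le_ceil _
      have hm0 : 0 < mtilde * ((1 : ℝ) + k) ^ (ν / (1 + ν)) :=
        mul_pos hmtilde (Real.rpow_pos_of_pos (hk1 k) _)
      have hp : ((1 : ℝ) + k) ^ (1 / (1 + ν)) * ((1 : ℝ) + k) ^ (ν / (1 + ν)) = 1 + k := by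
        rw [← Real.rpow_add (hk1 k), ← add_div, div_self h1ν.ne', Real.rpow_one]
      calc γ k * (σ ^ 2 / mb k) ≤ γ k * (σ ^ 2 / (mtilde * ((1 : ℝ) + k) ^ (ν / (1 + ν)))) := by
            gcongr
        _ = γtilde * σ ^ 2 / mtilde * (1 / (((1 : ℝ) + k) ^ (1 / (1 + ν)) * ((1 : ℝ) + k) ^ (ν / (1 + ν)))) := by
            rw [hγdef]; field_simp
        _ = _ := by rw [hp]
    have hs := hstep k
    have s1 : 3 * L ^ 2 * γ k ^ (1 + 2 * ν) * (1 + σ ^ (1 + ν)) ≤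
      3 * L ^ 2 * ((γtilde ^ ν * γtilde ^ (1 + ν)) * (1 / (1 + k))) * (1 + σ ^ (1 + ν)) := by
      gcongr
    rw [g1] at hs
    linarith
  have hFlow : ∀ k, fstar ≤ F k := fun k => by
    have := integral_mono (integrable_const fstar) (hfint k) (fun ω => hfstar _ (hxmem k ω))
    simpa using this
  have hsum : ∀ N : ℕ, ∑ k ∈ Finset.range N, γ k * D k ^ 2 ≤
      6 * (F 0 - F N) + K * ∑ k ∈ Finset.range N, (1 / (1 + (k:ℝ))) := by
    intro N
    induction N with
    | zero => simp
    | succ n ih =>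
      rw [Finset.sum_range_succ, Finset.sum_range_succ]
      have := hK n
      linarith
  have hharm : ∀ N : ℕ, ∑ k ∈ Finset.range N, (1 / (1 + (k:ℝ))) ≤ 1 + Real.log N := by
    intro N
    have := harmonic_le_one_add_log N
    refine le_trans (le_of_eq ?_) this
    simp [harmonic, add_comm]
  have hl2 : 0 < Real.log 2 := Real.log_pos (by norm_num)
  have hA0 : 0 ≤ 6 * (F 0 - fstar) := by linarith [hFlow 0]
  set A := 6 * (F 0 - fstar)
  set K' := (A + K) / Real.log 2 + K with hK'
  have hK'0 : 0 ≤ K' := by positivity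
  refine ⟨Real.sqrt (K' / γtilde) + 1, by positivity, fun N hN => ?_⟩
  have hN0 : (0:ℝ) < N := by positivity
  set M := Finset.inf' (Finset.range N) (Finset.nonempty_range_iff.mpr (by omega)) D with hM
  have hM0 : 0 ≤ M := by
    rw [hM, Finset.le_inf'_iff]; exact fun k _ => hD0 k
  have hMD : ∀ k ∈ Finset.range N, M ≤ D k := fun k hk => Finset.inf'_le _ hk
  have hlog : Real.log 2 ≤ Real.log N := Real.log_le_log (by norm_num) (by exact_mod_cast hN)
  have hup : ∑ k ∈ Finset.range N, γ k * D k ^ 2 ≤ K' * Real.log N := by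
    have h1 := hsum N
    have h2 := mul_le_mul_of_nonneg_left (hharm N) hK0
    have h3 := hFlow N
    have h4 : A + K ≤ (A + K) / Real.log 2 * Real.log N := by
      rw [div_mul_eq_mul_div, le_div_iff₀ hl2]
      gcongr
    have h5 : 6 * (F 0 - F N) ≤ A := by simp only [A]; linarith
    rw [hK', add_mul]
    linarith
  have hlow : γtilde * (N:ℝ) ^ (ν / (1 + ν)) * M ^ 2 ≤ ∑ k ∈ Finset.range N, γ k * D k ^ 2 := by
    have hc : ∀ k ∈ Finset.range N, γtilde / (N:ℝ) ^ (1 / (1 + ν)) * M ^ 2 ≤ γ k * D k ^ 2 := by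
      intro k hk
      have hkN : 1 + (k:ℝ) ≤ N := by
        have := Finset.mem_range.mp hk
        have : 1 + k ≤ N := by omega
        exact_mod_cast this
      have := hMD k hk
      have hg := hγpos k
      rw [hγdef] at hg ⊢
      have := hk1 k
      gcongr
    have := Finset.card_nsmul_le_sum _ _ _ hc
    rw [Finset.card_range, nsmul_eq_mul] at this
    refine le_trans (le_of_eq ?_) this
    have hp : (N:ℝ) ^ (1 / (1 + ν)) * (N:ℝ) ^ (ν / (1 + ν)) = N := by
      rw [← Real.rpow_add hN0, ← add_div, div_self h1ν.ne', Real.rpow_one]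
    have hp0 : 0 < (N:ℝ) ^ (1 / (1 + ν)) := Real.rpow_pos_of_pos hN0 _
    rw [div_mul_eq_mul_div, mul_div_assoc', eq_div_iff hp0.ne']
    linear_combination (γtilde * M ^ 2) * hp
  have hp0 : 0 < (N:ℝ) ^ (ν / (1 + ν)) := Real.rpow_pos_of_pos hN0 _
  have hfin : M ^ 2 ≤ (K' / γtilde) * (Real.log N / (N:ℝ) ^ (ν / (1 + ν))) := by
    rw [div_mul_div_comm, le_div_iff₀ (by positivity)]
    linarith
  have hfin2 : M ≤ Real.sqrt (K' / γtilde) * Real.sqrt (Real.log N / (N:ℝ) ^ (ν / (1 + ν))) := by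
    rw [← Real.sqrt_mul (by positivity)]
    exact Real.le_sqrt_of_sq_le hfin
  have := Real.sqrt_nonneg (Real.log N / (N:ℝ) ^ (ν / (1 + ν)))
  linarith
end
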